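/- Let p0, p1, p2 ∈ R_{2,1} have no common zeros on P^1 × P^1, be generic, and suppose p0, p1 form a regular sequence in R. Write p_i = C_i(z,w) x^2 + D_i(z,w) xy + E_i(z,w) y^2 with C_i, D_i, E_i ∈ R_{0,1}, and p_i = A_i(x,y) z + B_i(x,y) w with A_i, B_i ∈ R_{2,0}. Set k1 := (C0 x + D0 y) E1 − (C1 x + D1 y) E0, k2 := C0 (D1 x + E1 y) − C1 (D0 x + E0 y), and g := A0 B1 − A1 B0. Then the ideal quotient (⟨p0, p1⟩ : p2) equals the ideal ⟨p0, p1, k1, k2, g⟩. -/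

import Mathlib

open MvPolynomial

noncomputable section

/-- The bigraded polynomial ring `R = k[x,y,z,w]`; variables `0,1,2,3` are `x,y,z,w`. -/
abbrev Rk (k : Type*) [Field k] := MvPolynomial (Fin 4) k

/-- The bigrading: `x, y` have degree `(1,0)`; `z, w` have degree `(0,1)`. -/
def bidegWt : Fin 4 → ℤ × ℤ := ![(1, 0), (1, 0), (0, 1), (0, 1)]

/-- `p` is bihomogeneous of bidegree `(m, n)` (with the convention that only the zero
polynomial is bihomogeneous of a bidegree with a negative coordinate). -/
def Bihom {k : Type*} [Field k] (p : Rk k) (m n : ℤ) : Prop :=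
  p.IsWeightedHomogeneous bidegWt (m, n)

/-- `p0, p1, p2` have no common zeros on `ℙ¹ × ℙ¹`. -/
def NoCommonZeros {k : Type*} [Field k] (p0 p1 p2 : Rk k) : Prop :=
  ∀ a b c d : k, (a, b) ≠ (0, 0) → (c, d) ≠ (0, 0) →
    eval ![a, b, c, d] p0 ≠ 0 ∨ eval ![a, b, c, d] p1 ≠ 0 ∨ eval ![a, b, c, d] p2 ≠ 0

/-- The map `(A0, A1, A2) ↦ A0 p0 + A1 p1 + A2 p2`, as a `k`-linear map on `R³`. -/
def syzMapk {k : Type*} [Field k] (p : Fin 3 → Rk k) : (Fin 3 → Rk k) →ₗ[k] Rk k :=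
  ∑ i : Fin 3, (LinearMap.mulRight k (p i)).comp (LinearMap.proj i)

/-- The bigraded piece `Syz(p)_{m,n}`: triples `(A0, A1, A2)` of bihomogeneous polynomials of
bidegree `(m-2, n-1)` with `A0 p0 + A1 p1 + A2 p2 = 0`, as a `k`-subspace of `R³`. -/
def SyzPiece {k : Type*} [Field k] (p : Fin 3 → Rk k) (m n : ℤ) :
    Submodule k (Fin 3 → Rk k) :=
  (Submodule.pi Set.univ fun _ => weightedHomogeneousSubmodule k bidegWt (m - 2, n - 1)) ⊓
    LinearMap.ker (syzMapk p)

/-- The syzygy module `Syz(p)`, as an `R`-submodule of `R³`. -/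
def Syz {k : Type*} [Field k] (p : Fin 3 → Rk k) : Submodule (Rk k) (Fin 3 → Rk k) :=
  LinearMap.ker (∑ i : Fin 3, (LinearMap.mulRight (Rk k) (p i)).comp (LinearMap.proj i))

/-- The Koszul submodule of `R³`: the `R`-submodule generated by the three Koszul syzygies
`(p1, −p0, 0)`, `(p2, 0, −p0)`, `(0, p2, −p1)`. -/
def KoszulSub {k : Type*} [Field k] (p0 p1 p2 : Rk k) : Submodule (Rk k) (Fin 3 → Rk k) :=
  Submodule.span (Rk k) {![p1, -p0, 0], ![p2, 0, -p0], ![0, p2, -p1]}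

/-- `p0, p1, p2 ∈ R_{2,1}` are generic: only finitely many points `[a0 : a1 : a2]` of `ℙ²(k)`
are such that `a0 p0 + a1 p1 + a2 p2` factors as `q · l` with `q ∈ R_{2,0}`, `l ∈ R_{0,1}`. -/
def BidegGeneric {k : Type*} [Field k] (p0 p1 p2 : Rk k) : Prop :=
  {P : Projectivization k (Fin 3 → k) |
    ∃ q l : Rk k, Bihom q 2 0 ∧ Bihom l 0 1 ∧
      P.rep 0 • p0 + P.rep 1 • p1 + P.rep 2 • p2 = q * l}.Finite

theorem IsRelPrime.exists_eq_mul_of_mul_eq_mul {R : Type*} [CommRing R] [IsDomain R]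
    [DecompositionMonoid R] {x y a b : R} (h : IsRelPrime x y) (hx : x ≠ 0)
    (e : y * a = x * b) : ∃ c, a = x * c ∧ b = y * c := by
  obtain ⟨c, rfl⟩ := h.dvd_of_dvd_mul_left (Dvd.intro b e.symm)
  exact ⟨c, rfl, mul_left_cancel₀ hx (by linear_combination -e)⟩

section Linkage

variable {R : Type*} [CommRing R] [IsDomain R] [DecompositionMonoid R]

/-- If `θ₁, θ₂, θ₃` is a regular sequence and `p, q` are relatively prime, then
no nonzero class modulo `⟨p, q⟩` is annihilated by all three `θᵢ`. -/
theorem mem_span_pair_of_three_mul_mem {p q h t1 t2 t3 : R} (hp : p ≠ 0) (hpq : IsRelPrime p q)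
    (ht1 : t1 ≠ 0) (ht12 : IsRelPrime t1 t2)
    (ht3 : ∀ c, t3 * c ∈ Ideal.span {t1, t2} → c ∈ Ideal.span {t1, t2})
    (h1 : t1 * h ∈ Ideal.span {p, q}) (h2 : t2 * h ∈ Ideal.span {p, q})
    (h3 : t3 * h ∈ Ideal.span {p, q}) : h ∈ Ideal.span {p, q} := by
  simp only [Ideal.mem_span_pair] at *
  obtain ⟨a1, b1, e1⟩ := h1
  obtain ⟨a2, b2, e2⟩ := h2
  obtain ⟨a3, b3, e3⟩ := h3
  obtain ⟨c12, hb12, ha12⟩ := hpq.exists_eq_mul_of_mul_eq_mul hp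
    (a := t2 * b1 - t1 * b2) (b := -(t2 * a1 - t1 * a2))
    (by linear_combination t2 * e1 - t1 * e2)
  obtain ⟨c13, hb13, ha13⟩ := hpq.exists_eq_mul_of_mul_eq_mul hp
    (a := t3 * b1 - t1 * b3) (b := -(t3 * a1 - t1 * a3))
    (by linear_combination t3 * e1 - t1 * e3)
  obtain ⟨c23, hb23, ha23⟩ := hpq.exists_eq_mul_of_mul_eq_mul hp
    (a := t3 * b2 - t2 * b3) (b := -(t3 * a2 - t2 * a3))
    (by linear_combination t3 * e2 - t2 * e3)
  have hc : t3 * c12 = t2 * c13 - t1 * c23 := mul_left_cancel₀ hp (by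
    linear_combination -t3 * hb12 + t2 * hb13 - t1 * hb23)
  obtain ⟨n, m, e⟩ := ht3 c12 ⟨-c23, c13, by rw [hc]; ring⟩
  obtain ⟨c, hc1, hc2⟩ := ht12.exists_eq_mul_of_mul_eq_mul ht1
    (a := t3 * m - c13) (b := -(t3 * n + c23)) (by linear_combination t3 * e + hc)
  obtain ⟨b, hb1, hb2⟩ := ht12.exists_eq_mul_of_mul_eq_mul ht1
    (a := b1 - p * m) (b := b2 + p * n) (by linear_combination hb12 - p * e)
  obtain ⟨a, ha1, ha2⟩ := ht12.exists_eq_mul_of_mul_eq_mul ht1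
    (a := a1 + q * m) (b := a2 - q * n) (by linear_combination -ha12 + q * e)
  exact ⟨a, b, mul_left_cancel₀ ht1 (by linear_combination e1 - p * ha1 - q * hb1)⟩

/-- An element whose multiplication becomes harmless after a ring map `ψ` congruent to the
identity modulo it is regular modulo `⟨s, t⟩`. -/
theorem mem_span_pair_of_mul_mem {l s t : R} (ψ : R →+* R) (hψ : ∀ u, l ∣ u - ψ u)
    (hl : ψ l = 0) (hl0 : l ≠ 0) (hs : ψ s ≠ 0) (hst : IsRelPrime (ψ s) (ψ t)) (c : R)
    (hc : l * c ∈ Ideal.span {s, t}) : c ∈ Ideal.span {s, t} := by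
  simp only [Ideal.mem_span_pair] at *
  obtain ⟨v, w, e⟩ := hc
  have e' := congrArg ψ e
  simp only [map_add, map_mul, hl, zero_mul] at e'
  obtain ⟨d, hw, hv⟩ := hst.exists_eq_mul_of_mul_eq_mul hs (a := ψ w) (b := -ψ v)
    (by linear_combination e')
  obtain ⟨v', hv'⟩ := hψ v
  obtain ⟨w', hw'⟩ := hψ w
  obtain ⟨s', hs'⟩ := hψ s
  obtain ⟨t', ht'⟩ := hψ t
  refine ⟨v' + t' * d, w' - s' * d, mul_left_cancel₀ hl0 ?_⟩
  linear_combination e - s * (hv' + d * ht' - hv) - t * (hw' - d * hs' + hw)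

theorem exists_eq_add_sq_mul {x y C D E a0 a1 a2 s t : R} (hx : x ≠ 0) (hxy : IsRelPrime x y)
    (h1 : y * a0 - x * a1 = -(s * (C * x ^ 2 + D * (x * y) + E * y ^ 2)))
    (h2 : y * a1 - x * a2 = -(t * (C * x ^ 2 + D * (x * y) + E * y ^ 2))) :
    ∃ a, a0 = -(s * (D * x + E * y)) - t * E * x + x ^ 2 * a := by
  obtain ⟨u, hu, hu'⟩ := hxy.exists_eq_mul_of_mul_eq_mul hx
    (a := a0 + s * (E * y + D * x)) (b := a1 - s * C * x) (by linear_combination h1)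
  obtain ⟨v, hv, -⟩ := hxy.exists_eq_mul_of_mul_eq_mul hx
    (a := a1 + t * (E * y + D * x)) (b := a2 - t * C * x) (by linear_combination h2)
  obtain ⟨a, ha, -⟩ := hxy.exists_eq_mul_of_mul_eq_mul hx
    (a := u + t * E) (b := v - t * D - s * C) (by linear_combination hv - hu')
  exact ⟨a, by linear_combination hu + x * ha⟩

/-- The case of `mem_span_of_mul_mem` in which the comparison syzygies are already multiples of
`x ^ 2, x * y, y ^ 2`. -/
theorem mem_span_of_syzygies {x y z w p q C0 D0 E0 C1 D1 E1 A0 B0 A1 B1 f : R}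
    (hx : x ≠ 0) (hz : z ≠ 0) (hxy : IsRelPrime x y) (hzw : IsRelPrime z w)
    (hp : p ≠ 0) (hpq : IsRelPrime p q)
    (hpC : p = C0 * x ^ 2 + D0 * (x * y) + E0 * y ^ 2)
    (hqC : q = C1 * x ^ 2 + D1 * (x * y) + E1 * y ^ 2)
    (hpA : p = A0 * z + B0 * w) (hqA : q = A1 * z + B1 * w)
    {a0 b0 a1 b1 a2 b2 c0 d0 c1 d1 c2 d2 r : R}
    (h0 : a0 * p + b0 * q = x ^ 2 * z * f) (h1 : a1 * p + b1 * q = x * y * z * f)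
    (h2 : a2 * p + b2 * q = y ^ 2 * z * f)
    (h0' : c0 * p + d0 * q = x ^ 2 * w * f) (h1' : c1 * p + d1 * q = x * y * w * f)
    (h2' : c2 * p + d2 * q = y ^ 2 * w * f)
    (hb0 : w * b0 - z * d0 = p * (x ^ 2 * r)) (hb1 : w * b1 - z * d1 = p * (x * y * r))
    (hb2 : w * b2 - z * d2 = p * (y ^ 2 * r)) (ha0 : w * a0 - z * c0 = -(q * (x ^ 2 * r))) :
    f ∈ Ideal.span {p, q, (C0 * x + D0 * y) * E1 - (C1 * x + D1 * y) * E0,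
      C0 * (D1 * x + E1 * y) - C1 * (D0 * x + E0 * y), A0 * B1 - A1 * B0} := by
  obtain ⟨s, hs, hs'⟩ := hpq.exists_eq_mul_of_mul_eq_mul hp
    (a := y * b0 - x * b1) (b := -(y * a0 - x * a1)) (by linear_combination y * h0 - x * h1)
  obtain ⟨t, ht, ht'⟩ := hpq.exists_eq_mul_of_mul_eq_mul hp
    (a := y * b1 - x * b2) (b := -(y * a1 - x * a2)) (by linear_combination y * h1 - x * h2)
  obtain ⟨s₁, hs₁, hs₁'⟩ := hpq.exists_eq_mul_of_mul_eq_mul hp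
    (a := y * d0 - x * d1) (b := -(y * c0 - x * c1)) (by linear_combination y * h0' - x * h1')
  obtain ⟨t₁, ht₁, ht₁'⟩ := hpq.exists_eq_mul_of_mul_eq_mul hp
    (a := y * d1 - x * d2) (b := -(y * c1 - x * c2)) (by linear_combination y * h1' - x * h2')
  obtain ⟨s', hss, hss₁⟩ := hzw.exists_eq_mul_of_mul_eq_mul hz (a := s) (b := s₁)
    (mul_left_cancel₀ hp (by
      linear_combination -w * hs + z * hs₁ + y * hb0 - x * hb1))
  obtain ⟨t', htt, htt₁⟩ := hzw.exists_eq_mul_of_mul_eq_mul hz (a := t) (b := t₁)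
    (mul_left_cancel₀ hp (by
      linear_combination -w * ht + z * ht₁ + y * hb1 - x * hb2))
  obtain ⟨a, ha⟩ := exists_eq_add_sq_mul (C := C1) (D := D1) (E := E1) (s := s) (t := t)
    (a0 := a0) (a1 := a1) (a2 := a2) hx hxy
    (by linear_combination -hs' - s * hqC) (by linear_combination -ht' - t * hqC)
  obtain ⟨c, hc⟩ := exists_eq_add_sq_mul (C := C1) (D := D1) (E := E1) (s := s₁) (t := t₁)
    (a0 := c0) (a1 := c1) (a2 := c2) hx hxy
    (by linear_combination -hs₁' - s₁ * hqC) (by linear_combination -ht₁' - t₁ * hqC)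
  obtain ⟨b, hb⟩ := exists_eq_add_sq_mul (C := C0) (D := D0) (E := E0) (s := -s) (t := -t)
    (a0 := b0) (a1 := b1) (a2 := b2) hx hxy
    (by linear_combination hs + s * hpC) (by linear_combination ht + t * hpC)
  obtain ⟨d, hd⟩ := exists_eq_add_sq_mul (C := C0) (D := D0) (E := E0) (s := -s₁) (t := -t₁)
    (a0 := d0) (a1 := d1) (a2 := d2) hx hxy
    (by linear_combination hs₁ + s₁ * hpC) (by linear_combination ht₁ + t₁ * hpC)
  obtain ⟨a', ha', -⟩ := hzw.exists_eq_mul_of_mul_eq_mul hz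
    (a := a + B1 * r) (b := c - A1 * r) (mul_left_cancel₀ (pow_ne_zero 2 hx) (by
      rw [ha, hc, hss, hss₁, htt, htt₁] at ha0
      linear_combination ha0 - x ^ 2 * r * hqA))
  obtain ⟨b', hb', -⟩ := hzw.exists_eq_mul_of_mul_eq_mul hz
    (a := b - B0 * r) (b := d + A0 * r) (mul_left_cancel₀ (pow_ne_zero 2 hx) (by
      rw [hb, hd, hss, hss₁, htt, htt₁] at hb0
      linear_combination hb0 + x ^ 2 * r * hpA))
  have hf : f = a' * p + b' * q
      - t' * ((C0 * x + D0 * y) * E1 - (C1 * x + D1 * y) * E0)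
      - s' * (C0 * (D1 * x + E1 * y) - C1 * (D0 * x + E0 * y))
      - r * (A0 * B1 - A1 * B0) := by
    refine mul_left_cancel₀ (mul_ne_zero (pow_ne_zero 2 hx) hz) ?_
    rw [← h0, ha, hb, hss, htt]
    have e1 : a = z * a' - B1 * r := by linear_combination ha'
    have e2 : b = z * b' + B0 * r := by linear_combination hb'
    rw [e1, e2]
    linear_combination (x ^ 2 * r) * (B0 * hqA - B1 * hpA)
      + (-(z * s' * (D1 * x + E1 * y)) - z * t' * E1 * x) * hpC
      + (z * s' * (D0 * x + E0 * y) + z * t' * E0 * x) * hqC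
  rw [hf]
  refine sub_mem (sub_mem (sub_mem (add_mem ?_ ?_) ?_) ?_) ?_ <;>
    exact Ideal.mul_mem_left _ _ (Ideal.subset_span (by simp))

/-- The ideal quotient `⟨p, q⟩ : ⟨x, y⟩² ⟨z, w⟩` is contained in the explicit ideal obtained by
linkage from the two decompositions of `p` and `q`. -/
theorem mem_span_of_mul_mem {x y z w p q C0 D0 E0 C1 D1 E1 A0 B0 A1 B1 f : R}
    (hx : x ≠ 0) (hz : z ≠ 0) (hxy : IsRelPrime x y) (hzw : IsRelPrime z w)
    (hp : p ≠ 0) (hpq : IsRelPrime p q)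
    (hpC : p = C0 * x ^ 2 + D0 * (x * y) + E0 * y ^ 2)
    (hqC : q = C1 * x ^ 2 + D1 * (x * y) + E1 * y ^ 2)
    (hpA : p = A0 * z + B0 * w) (hqA : q = A1 * z + B1 * w)
    (φ : R →+* R) (hφx : φ x = x) (hφy : φ y = y) (hφz : φ z = 0) (hφw : φ w = 0)
    (hφ : ∀ u, u - φ u ∈ Ideal.span {z, w})
    (h0 : x ^ 2 * z * f ∈ Ideal.span {p, q}) (h1 : x * y * z * f ∈ Ideal.span {p, q})
    (h2 : y ^ 2 * z * f ∈ Ideal.span {p, q})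
    (h0' : x ^ 2 * w * f ∈ Ideal.span {p, q}) (h1' : x * y * w * f ∈ Ideal.span {p, q})
    (h2' : y ^ 2 * w * f ∈ Ideal.span {p, q}) :
    f ∈ Ideal.span {p, q, (C0 * x + D0 * y) * E1 - (C1 * x + D1 * y) * E0,
      C0 * (D1 * x + E1 * y) - C1 * (D0 * x + E0 * y), A0 * B1 - A1 * B0} := by
  simp only [Ideal.mem_span_pair] at hφ h0 h1 h2 h0' h1' h2'
  obtain ⟨a0, b0, h0⟩ := h0
  obtain ⟨a1, b1, h1⟩ := h1
  obtain ⟨a2, b2, h2⟩ := h2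
  obtain ⟨c0, d0, h0'⟩ := h0'
  obtain ⟨c1, d1, h1'⟩ := h1'
  obtain ⟨c2, d2, h2'⟩ := h2'
  obtain ⟨s0, hb0, ha0⟩ := hpq.exists_eq_mul_of_mul_eq_mul hp
    (a := w * b0 - z * d0) (b := -(w * a0 - z * c0)) (by linear_combination w * h0 - z * h0')
  obtain ⟨s1, hb1, ha1⟩ := hpq.exists_eq_mul_of_mul_eq_mul hp
    (a := w * b1 - z * d1) (b := -(w * a1 - z * c1)) (by linear_combination w * h1 - z * h1')
  obtain ⟨s2, hb2, ha2⟩ := hpq.exists_eq_mul_of_mul_eq_mul hp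
    (a := w * b2 - z * d2) (b := -(w * a2 - z * c2)) (by linear_combination w * h2 - z * h2')
  obtain ⟨s, hs, -⟩ := hpq.exists_eq_mul_of_mul_eq_mul hp
    (a := y * b0 - x * b1) (b := -(y * a0 - x * a1)) (by linear_combination y * h0 - x * h1)
  obtain ⟨t, ht, -⟩ := hpq.exists_eq_mul_of_mul_eq_mul hp
    (a := y * b1 - x * b2) (b := -(y * a1 - x * a2)) (by linear_combination y * h1 - x * h2)
  obtain ⟨s', hs', -⟩ := hpq.exists_eq_mul_of_mul_eq_mul hp
    (a := y * d0 - x * d1) (b := -(y * c0 - x * c1)) (by linear_combination y * h0' - x * h1')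
  obtain ⟨t', ht', -⟩ := hpq.exists_eq_mul_of_mul_eq_mul hp
    (a := y * d1 - x * d2) (b := -(y * c1 - x * c2)) (by linear_combination y * h1' - x * h2')
  have e1 : w * s - z * s' = y * s0 - x * s1 := mul_left_cancel₀ hp (by
    linear_combination -w * hs + z * hs' + y * hb0 - x * hb1)
  have e2 : w * t - z * t' = y * s1 - x * s2 := mul_left_cancel₀ hp (by
    linear_combination -w * ht + z * ht' + y * hb1 - x * hb2)
  replace e1 := congrArg φ e1
  replace e2 := congrArg φ e2
  simp only [map_sub, map_mul, hφx, hφy, hφz, hφw, zero_mul, sub_zero] at e1 e2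
  obtain ⟨c, hc0, hc1⟩ := hxy.exists_eq_mul_of_mul_eq_mul hx (a := φ s0) (b := φ s1)
    (by linear_combination -e1)
  obtain ⟨e, he1, he2⟩ := hxy.exists_eq_mul_of_mul_eq_mul hx (a := φ s1) (b := φ s2)
    (by linear_combination -e2)
  obtain ⟨r, hr, hr'⟩ := hxy.exists_eq_mul_of_mul_eq_mul hx (a := c) (b := e)
    (by linear_combination he1 - hc1)
  obtain ⟨u0, v0, k0⟩ := hφ s0
  obtain ⟨u1, v1, k1⟩ := hφ s1
  obtain ⟨u2, v2, k2⟩ := hφ s2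
  rw [hc0, hr] at k0
  rw [hc1, hr] at k1
  rw [he2, hr'] at k2
  exact mem_span_of_syzygies hx hz hxy hzw hp hpq hpC hqC hpA hqA (r := r)
    (a0 := a0 + q * v0) (b0 := b0 - p * v0) (c0 := c0 - q * u0) (d0 := d0 + p * u0)
    (a1 := a1 + q * v1) (b1 := b1 - p * v1) (c1 := c1 - q * u1) (d1 := d1 + p * u1)
    (a2 := a2 + q * v2) (b2 := b2 - p * v2) (c2 := c2 - q * u2) (d2 := d2 + p * u2)
    (by linear_combination h0) (by linear_combination h1) (by linear_combination h2)
    (by linear_combination h0') (by linear_combination h1') (by linear_combination h2')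
    (by linear_combination hb0 - p * k0) (by linear_combination hb1 - p * k1)
    (by linear_combination hb2 - p * k2) (by linear_combination -ha0 + q * k0)

end Linkage

section Polynomial

variable {k : Type*} [Field k]

theorem MvPolynomial.isRelPrime_of_mem_supported {σ : Type*} {s t : Set σ} (hst : Disjoint s t)
    {p q : MvPolynomial σ k} (hp : p ∈ supported k s) (hq : q ∈ supported k t)
    (hp0 : p ≠ 0) (hq0 : q ≠ 0) : IsRelPrime p q := by
  have key : ∀ {s : Set σ} {p d : MvPolynomial σ k}, p ∈ supported k s → p ≠ 0 → d ∣ p →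
      (d.vars : Set σ) ⊆ s := by
    rintro s _ d hp hp0 ⟨u, rfl⟩
    classical
    refine subset_trans (fun i hi => ?_) (mem_supported.1 hp)
    have hd : d ≠ 0 := left_ne_zero_of_mul hp0
    have hu : u ≠ 0 := right_ne_zero_of_mul hp0
    simp only [vars_def, Finset.mem_coe, Multiset.mem_toFinset] at hi ⊢
    rw [degrees_mul_eq hd hu]
    exact Multiset.mem_add.2 (Or.inl hi)
  intro d hdp hdq
  have hd : d.vars = ∅ := by
    rw [← Finset.coe_eq_empty, ← Set.subset_empty_iff]
    exact hst (key hp hp0 hdp) (key hq hq0 hdq)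
  rw [vars_eq_empty_iff_eq_C] at hd
  have hd0 : d ≠ 0 := ne_zero_of_dvd_ne_zero hp0 hdp
  rw [hd] at hd0 ⊢
  exact (isUnit_iff_ne_zero.2 fun h => hd0 (by rw [h, C_0])).map C

theorem MvPolynomial.sub_aeval_mem {σ : Type*} {I : Ideal (MvPolynomial σ k)}
    {v : σ → MvPolynomial σ k} (hv : ∀ i, X i - v i ∈ I) (p : MvPolynomial σ k) :
    p - aeval v p ∈ I := by
  have h : Ideal.Quotient.mkₐ k I = (Ideal.Quotient.mkₐ k I).comp (aeval v) := by
    ext i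
    simpa using Ideal.Quotient.eq.2 (hv i)
  exact Ideal.Quotient.eq.1 (DFunLike.congr_fun h p)

theorem MvPolynomial.aeval_eq_self_of_mem_supported {σ : Type*} {s : Set σ}
    {v : σ → MvPolynomial σ k} (hv : ∀ i ∈ s, v i = X i) {p : MvPolynomial σ k}
    (hp : p ∈ supported k s) : aeval v p = p := by
  suffices supported k s ≤ AlgHom.equalizer (aeval v) (AlgHom.id k _) from this hp
  rw [supported_eq_adjoin_X, Algebra.adjoin_le_iff]
  rintro _ ⟨i, hi, rfl⟩
  simp [hv i hi]

theorem MvPolynomial.aeval_mem_supported {σ : Type*} {s : Set σ}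
    {v : σ → MvPolynomial σ k} (hv : ∀ i ∈ s, v i ∈ supported k s) {p : MvPolynomial σ k}
    (hp : p ∈ supported k s) : aeval v p ∈ supported k s := by
  suffices supported k s ≤ (supported k s).comap (aeval v) from this hp
  rw [supported_eq_adjoin_X, Algebra.adjoin_le_iff]
  rintro _ ⟨i, hi, rfl⟩
  simpa [supported_eq_adjoin_X] using hv i hi

theorem Bihom.degree_eq {p : Rk k} {m n : ℤ} (hp : Bihom p m n) {d : Fin 4 →₀ ℕ}
    (hd : d ∈ p.support) : (d 0 : ℤ) + d 1 = m ∧ (d 2 : ℤ) + d 3 = n := by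
  have h := hp (mem_support_iff.1 hd)
  rw [Finsupp.weight_apply, Finsupp.sum_fintype _ _ (by simp), Fin.sum_univ_four] at h
  simpa [bidegWt, Prod.ext_iff] using h

theorem monomial_fin_four (d : Fin 4 →₀ ℕ) (c : k) :
    monomial d c = C c * (X 0 ^ d 0 * X 1 ^ d 1 * X 2 ^ d 2 * X 3 ^ d 3) := by
  rw [monomial_eq, Finsupp.prod_fintype _ _ (by simp), Fin.prod_univ_four]

/-- The bihomogeneous polynomial of bidegree `(2, 0)` with given coefficients. -/
def quadForm (u : Fin 3 → k) : Rk k :=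
  C (u 0) * X 0 ^ 2 + C (u 1) * (X 0 * X 1) + C (u 2) * X 1 ^ 2

theorem Bihom.exists_linear {p : Rk k} (hp : Bihom p 0 1) :
    ∃ a b : k, p = C a * X 2 + C b * X 3 := by
  rw [p.as_sum]
  refine Finset.sum_induction _ (fun p => ∃ a b : k, p = C a * X 2 + C b * X 3) ?_ ?_ ?_
  · rintro _ _ ⟨a, b, rfl⟩ ⟨a', b', rfl⟩
    exact ⟨a + a', b + b', by simp only [C_add]; ring⟩
  · exact ⟨0, 0, by simp⟩
  · intro d hd
    obtain ⟨h1, h2⟩ := hp.degree_eq hd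
    have h0 : d 0 = 0 := by omega
    have h1 : d 1 = 0 := by omega
    rw [monomial_fin_four, h0, h1]
    obtain ⟨h2, h3⟩ | ⟨h2, h3⟩ : (d 2 = 1 ∧ d 3 = 0) ∨ (d 2 = 0 ∧ d 3 = 1) := by omega
    · exact ⟨coeff d p, 0, by rw [h2, h3, C_0]; ring⟩
    · exact ⟨0, coeff d p, by rw [h2, h3, C_0]; ring⟩

theorem quadForm_add (u v : Fin 3 → k) : quadForm (u + v) = quadForm u + quadForm v := by
  simp only [quadForm, Pi.add_apply, C_add]
  ring

theorem quadForm_smul (c : k) (u : Fin 3 → k) : quadForm (c • u) = C c * quadForm u := by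
  simp only [quadForm, Pi.smul_apply, smul_eq_mul, C_mul]
  ring

theorem quadForm_zero : quadForm (0 : Fin 3 → k) = 0 := by simp [quadForm]

theorem Bihom.exists_quadForm {p : Rk k} (hp : Bihom p 2 1) :
    ∃ u v : Fin 3 → k, p = quadForm u * X 2 + quadForm v * X 3 := by
  rw [p.as_sum]
  refine Finset.sum_induction _
    (fun p => ∃ u v : Fin 3 → k, p = quadForm u * X 2 + quadForm v * X 3) ?_ ?_ ?_
  · rintro _ _ ⟨a, b, rfl⟩ ⟨a', b', rfl⟩
    exact ⟨a + a', b + b', by simp only [quadForm_add]; ring⟩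
  · exact ⟨0, 0, by simp [quadForm_zero]⟩
  · intro d hd
    obtain ⟨h1, h2⟩ := hp.degree_eq hd
    obtain ⟨u, hu⟩ : ∃ u : Fin 3 → k, C (coeff d p) * (X 0 ^ d 0 * X 1 ^ d 1) = quadForm u := by
      obtain ⟨h0, h1⟩ | ⟨h0, h1⟩ | ⟨h0, h1⟩ :
          (d 0 = 2 ∧ d 1 = 0) ∨ (d 0 = 1 ∧ d 1 = 1) ∨ (d 0 = 0 ∧ d 1 = 2) := by omega
      · exact ⟨![coeff d p, 0, 0], by simp [quadForm, h0, h1]⟩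
      · exact ⟨![0, coeff d p, 0], by simp [quadForm, h0, h1]⟩
      · exact ⟨![0, 0, coeff d p], by simp [quadForm, h0, h1]⟩
    rw [monomial_fin_four]
    obtain ⟨h2, h3⟩ | ⟨h2, h3⟩ : (d 2 = 1 ∧ d 3 = 0) ∨ (d 2 = 0 ∧ d 3 = 1) := by omega
    · exact ⟨u, 0, by rw [h2, h3, ← hu, quadForm_zero]; ring⟩
    · exact ⟨0, u, by rw [h2, h3, ← hu, quadForm_zero]; ring⟩

theorem Bihom.mem_supported_of_right_eq_zero {p : Rk k} {m : ℤ} (hp : Bihom p m 0) :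
    p ∈ supported k ({0, 1} : Set (Fin 4)) := by
  rw [p.as_sum]
  refine sum_mem fun d hd => ?_
  obtain ⟨h1, h2⟩ := hp.degree_eq hd
  rw [monomial_fin_four, show d 2 = 0 by omega, show d 3 = 0 by omega, pow_zero, pow_zero,
    mul_one, mul_one]
  exact mul_mem (Subalgebra.algebraMap_mem _ _) (mul_mem (pow_mem (X_mem_supported.2 (by simp)) _)
    (pow_mem (X_mem_supported.2 (by simp)) _))

theorem Bihom.mem_supported_of_left_eq_zero {p : Rk k} {n : ℤ} (hp : Bihom p 0 n) :
    p ∈ supported k ({2, 3} : Set (Fin 4)) := by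
  rw [p.as_sum]
  refine sum_mem fun d hd => ?_
  obtain ⟨h1, h2⟩ := hp.degree_eq hd
  rw [monomial_fin_four, show d 0 = 0 by omega, show d 1 = 0 by omega, pow_zero, pow_zero,
    mul_one, one_mul]
  exact mul_mem (Subalgebra.algebraMap_mem _ _) (mul_mem (pow_mem (X_mem_supported.2 (by simp)) _)
    (pow_mem (X_mem_supported.2 (by simp)) _))

theorem bihom_quadForm (u : Fin 3 → k) : Bihom (quadForm u) 2 0 := by
  have hX : ∀ i : Fin 4, IsWeightedHomogeneous bidegWt (X i : Rk k) (bidegWt i) :=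
    fun i => isWeightedHomogeneous_X k bidegWt i
  have hC : ∀ c : k, IsWeightedHomogeneous bidegWt (C c : Rk k) 0 :=
    fun c => isWeightedHomogeneous_C bidegWt c
  have h0 := ((hC (u 0)).mul ((hX 0).pow 2))
  have h1 := ((hC (u 1)).mul ((hX 0).mul (hX 1)))
  have h2 := ((hC (u 2)).mul ((hX 1).pow 2))
  simp only [bidegWt, Matrix.cons_val_zero, Matrix.cons_val_one, Prod.smul_mk, Prod.mk_add_mk,
    zero_add] at h0 h1 h2
  exact (h0.add h1).add h2

theorem bihom_X_sub (c : k) : Bihom (X 2 - C c * X 3 : Rk k) 0 1 := by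
  have h2 : IsWeightedHomogeneous bidegWt (X 2 : Rk k) (0, 1) :=
    isWeightedHomogeneous_X k bidegWt 2
  have h3 := (isWeightedHomogeneous_C bidegWt (-c)).mul
    (isWeightedHomogeneous_X k bidegWt (3 : Fin 4))
  rw [zero_add] at h3
  have := h2.add h3
  rwa [C_neg, neg_mul, ← sub_eq_add_neg] at this

/-- A binary quartic form over an algebraically closed field has a nontrivial zero. -/
theorem exists_zero_binary_quartic [IsAlgClosed k] (c0 c1 c2 c3 c4 : k) :
    ∃ a b : k, (a, b) ≠ (0, 0) ∧
      c0 * a ^ 4 + c1 * a ^ 3 * b + c2 * a ^ 2 * b ^ 2 + c3 * a * b ^ 3 + c4 * b ^ 4 = 0 := by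
  by_cases h : c0 = 0
  · exact ⟨1, 0, by simp, by simp [h]⟩
  · have hdeg : (Polynomial.C c0 * Polynomial.X ^ 4 + Polynomial.C c1 * Polynomial.X ^ 3
        + Polynomial.C c2 * Polynomial.X ^ 2 + Polynomial.C c3 * Polynomial.X
        + Polynomial.C c4).degree = 4 := by
      compute_degree!
    obtain ⟨a, ha⟩ := IsAlgClosed.exists_root _ (by rw [hdeg]; decide)
    refine ⟨a, 1, by simp, ?_⟩
    simpa [Polynomial.IsRoot] using ha

theorem exists_kernel_of_det_eq_zero {a b a' b' : k} (h : a * b' = a' * b) :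
    ∃ c d : k, (c, d) ≠ (0, 0) ∧ a * c + b * d = 0 ∧ a' * c + b' * d = 0 := by
  by_cases h0 : (b, -a) = (0, 0)
  · by_cases h1 : (b', -a') = (0, 0)
    · simp only [Prod.mk.injEq, neg_eq_zero] at h0 h1
      exact ⟨1, 0, by simp, by simp [h0], by simp [h1]⟩
    · exact ⟨b', -a', h1, by linear_combination h, by ring⟩
  · exact ⟨b, -a, h0, by ring, by linear_combination -h⟩

theorem eval_quadForm_add (u v : Fin 3 → k) (a b c d : k) :
    eval ![a, b, c, d] (quadForm u * X 2 + quadForm v * X 3) =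
      (u 0 * a ^ 2 + u 1 * (a * b) + u 2 * b ^ 2) * c +
        (v 0 * a ^ 2 + v 1 * (a * b) + v 2 * b ^ 2) * d := by
  simp [quadForm]

/-- Two forms of bidegree `(2, 1)` always meet on `ℙ¹ × ℙ¹`. -/
theorem exists_common_zero [IsAlgClosed k] (u v u' v' : Fin 3 → k) :
    ∃ a b c d : k, (a, b) ≠ (0, 0) ∧ (c, d) ≠ (0, 0) ∧
      eval ![a, b, c, d] (quadForm u * X 2 + quadForm v * X 3) = 0 ∧
      eval ![a, b, c, d] (quadForm u' * X 2 + quadForm v' * X 3) = 0 := by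
  obtain ⟨a, b, hab, h⟩ := exists_zero_binary_quartic (u 0 * v' 0 - u' 0 * v 0)
    (u 0 * v' 1 + u 1 * v' 0 - u' 0 * v 1 - u' 1 * v 0)
    (u 0 * v' 2 + u 1 * v' 1 + u 2 * v' 0 - u' 0 * v 2 - u' 1 * v 1 - u' 2 * v 0)
    (u 1 * v' 2 + u 2 * v' 1 - u' 1 * v 2 - u' 2 * v 1) (u 2 * v' 2 - u' 2 * v 2)
  obtain ⟨c, d, hcd, h1, h2⟩ := exists_kernel_of_det_eq_zero
    (a := u 0 * a ^ 2 + u 1 * (a * b) + u 2 * b ^ 2)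
    (b := v 0 * a ^ 2 + v 1 * (a * b) + v 2 * b ^ 2)
    (a' := u' 0 * a ^ 2 + u' 1 * (a * b) + u' 2 * b ^ 2)
    (b' := v' 0 * a ^ 2 + v' 1 * (a * b) + v' 2 * b ^ 2) (by linear_combination h)
  exact ⟨a, b, c, d, hab, hcd, by rw [eval_quadForm_add, h1], by rw [eval_quadForm_add, h2]⟩

theorem NoCommonZeros.eq_zero_of_smul_add_eq_zero [IsAlgClosed k] {p0 p1 p2 : Rk k}
    (h0 : Bihom p0 2 1) (h1 : Bihom p1 2 1) (h2 : Bihom p2 2 1)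
    (h : NoCommonZeros p0 p1 p2) {v : Fin 3 → k}
    (hv : v 0 • p0 + v 1 • p1 + v 2 • p2 = 0) : v = 0 := by
  obtain ⟨u0, u0', e0⟩ := h0.exists_quadForm
  obtain ⟨u1, u1', e1⟩ := h1.exists_quadForm
  obtain ⟨u2, u2', e2⟩ := h2.exists_quadForm
  have hev : ∀ P : Fin 4 → k, v 0 * eval P p0 + v 1 * eval P p1 + v 2 * eval P p2 = 0 := by
    intro P
    simpa using congrArg (eval P) hv
  ext i
  by_contra hi
  fin_cases i
  · obtain ⟨a, b, c, d, hab, hcd, z1, z2⟩ := exists_common_zero u1 u1' u2 u2'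
    rw [← e1] at z1
    rw [← e2] at z2
    have := hev ![a, b, c, d]
    rcases h a b c d hab hcd with h | h | h <;> simp_all
  · obtain ⟨a, b, c, d, hab, hcd, z1, z2⟩ := exists_common_zero u0 u0' u2 u2'
    rw [← e0] at z1
    rw [← e2] at z2
    have := hev ![a, b, c, d]
    rcases h a b c d hab hcd with h | h | h <;> simp_all
  · obtain ⟨a, b, c, d, hab, hcd, z1, z2⟩ := exists_common_zero u0 u0' u1 u1'
    rw [← e0] at z1
    rw [← e1] at z2
    have := hev ![a, b, c, d]
    rcases h a b c d hab hcd with h | h | h <;> simp_all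

theorem sum_smul_quadForm (M N : Matrix (Fin 3) (Fin 3) k) (v : Fin 3 → k) :
    v 0 • (quadForm (M 0) * X 2 + quadForm (N 0) * X 3) +
      v 1 • (quadForm (M 1) * X 2 + quadForm (N 1) * X 3) +
      v 2 • (quadForm (M 2) * X 2 + quadForm (N 2) * X 3) =
    quadForm (Matrix.vecMul v M) * X 2 + quadForm (Matrix.vecMul v N) * X 3 := by
  have h : ∀ M : Matrix (Fin 3) (Fin 3) k, Matrix.vecMul v M =
      v 0 • M 0 + v 1 • M 1 + v 2 • M 2 := by
    intro M
    ext j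
    simp [Matrix.vecMul, dotProduct, Fin.sum_univ_three]
  simp only [h, quadForm_add, quadForm_smul, smul_eq_C_mul]
  ring

/-- If the pencil of coefficient matrices were singular at every point, then every point would
give a factorable combination, against genericity. -/
theorem BidegGeneric.exists_det_ne_zero [IsAlgClosed k] {M N : Matrix (Fin 3) (Fin 3) k}
    {p0 p1 p2 : Rk k} (hM0 : p0 = quadForm (M 0) * X 2 + quadForm (N 0) * X 3)
    (hM1 : p1 = quadForm (M 1) * X 2 + quadForm (N 1) * X 3)
    (hM2 : p2 = quadForm (M 2) * X 2 + quadForm (N 2) * X 3)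
    (h0 : Bihom p0 2 1) (h1 : Bihom p1 2 1) (h2 : Bihom p2 2 1)
    (hncz : NoCommonZeros p0 p1 p2) (hgen : BidegGeneric p0 p1 p2) :
    ∃ c : k, (c • M + N).det ≠ 0 := by
  by_contra! hdet
  have hsum (v : Fin 3 → k) : v 0 • p0 + v 1 • p1 + v 2 • p2 =
      quadForm (Matrix.vecMul v M) * X 2 + quadForm (Matrix.vecMul v N) * X 3 := by
    rw [hM0, hM1, hM2, sum_smul_quadForm]
  have hpt (c : k) : ∃ P : Projectivization k (Fin 3 → k),
      Matrix.vecMul P.rep (c • M + N) = 0 := by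
    obtain ⟨v, hv, e⟩ := Matrix.exists_vecMul_eq_zero_iff.2 (hdet c)
    refine ⟨Projectivization.mk k v hv, ?_⟩
    obtain ⟨a, ha⟩ := Projectivization.exists_smul_eq_mk_rep k v hv
    rw [← ha, Units.smul_def, Matrix.smul_vecMul, e, smul_zero]
  choose P hP using hpt
  have hN (c : k) : Matrix.vecMul (P c).rep N = -(c • Matrix.vecMul (P c).rep M) := by
    have := hP c
    rw [Matrix.vecMul_add, Matrix.vecMul_smul] at this
    exact eq_neg_of_add_eq_zero_right this
  have hmem (c : k) : P c ∈ {P : Projectivization k (Fin 3 → k) |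
      ∃ q l : Rk k, Bihom q 2 0 ∧ Bihom l 0 1 ∧
        P.rep 0 • p0 + P.rep 1 • p1 + P.rep 2 • p2 = q * l} := by
    refine ⟨_, _, bihom_quadForm (Matrix.vecMul (P c).rep M), bihom_X_sub c, ?_⟩
    rw [hsum, hN, ← neg_smul, quadForm_smul, C_neg]
    ring
  obtain ⟨c, -, c', -, hne, he⟩ := Set.infinite_univ.exists_ne_map_eq_of_mapsTo
    (fun c _ => hmem c) hgen
  have hM : Matrix.vecMul (P c).rep M = 0 := by
    have h := hN c'
    rw [← he, hN c, neg_inj] at h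
    exact (smul_eq_zero.1 (show (c - c') • Matrix.vecMul (P c).rep M = 0 by
      rw [sub_smul, h, sub_self])).resolve_left
      (sub_ne_zero.2 hne)
  refine (P c).rep_nonzero (hncz.eq_zero_of_smul_add_eq_zero h0 h1 h2 ?_)
  rw [hsum, hN, hM, smul_zero, neg_zero, quadForm_zero]
  ring

end Polynomial

section Colon

variable {k : Type*} [Field k]

theorem mem_span_pair_of_X_sub_mul_mem {σ : Type*} {s t : Set σ} (hst : Disjoint s t) {i j : σ}
    (hij : i ≠ j) (hi : i ∈ s) (hj : j ∈ s) {f g : MvPolynomial σ k} (hf : f ∈ supported k t)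
    (hg : g ∈ supported k s) (hf0 : f ≠ 0) {P : σ → k} (hP : eval P g ≠ 0) (hPj : P j ≠ 0)
    (u : MvPolynomial σ k) (hu : (X i - C (P i / P j) * X j) * u ∈ Ideal.span {f, g}) :
    u ∈ Ideal.span {f, g} := by
  classical
  set v : σ → MvPolynomial σ k := Function.update X i (C (P i / P j) * X j) with hv
  have hvj : v j = X j := Function.update_of_ne hij.symm _ _
  have hvi : v i = C (P i / P j) * X j := Function.update_self ..
  have hvt : ∀ m ∈ t, v m = X m := fun m hm =>
    Function.update_of_ne (fun h : m = i => Set.disjoint_left.1 hst hi (by rwa [h] at hm)) _ _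
  have hvs : ∀ m ∈ s, v m ∈ supported k s := by
    intro m hm
    by_cases h : m = i
    · rw [h, hvi]
      exact mul_mem (Subalgebra.algebraMap_mem _ _) (X_mem_supported.2 hj)
    · rw [hv, Function.update_of_ne h]
      exact X_mem_supported.2 hm
  have hfe : aeval v f = f := aeval_eq_self_of_mem_supported hvt hf
  have hPg : eval P (aeval v g) = eval P g := by
    have h : (aeval P).comp (aeval v) = (aeval P : MvPolynomial σ k →ₐ[k] k) := by
      ext m
      by_cases h : m = i
      · subst h
        simp [hvi, hPj]
      · simp [hv, Function.update_of_ne h]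
    simpa [coe_aeval_eq_eval] using DFunLike.congr_fun h g
  have hg0 : aeval v g ≠ 0 := fun h => hP (by rw [← hPg, h, map_zero])
  refine mem_span_pair_of_mul_mem (aeval v : MvPolynomial σ k →ₐ[k] _).toRingHom
    (l := X i - C (P i / P j) * X j) (fun u => ?_) ?_ ?_ ?_ ?_ u hu
  · refine Ideal.mem_span_singleton.1 (sub_aeval_mem (fun m => ?_) u)
    by_cases h : m = i
    · rw [h, hvi]
      exact Ideal.mem_span_singleton_self _
    · simp [hv, Function.update_of_ne h]
  · simp [hvi, hvj]
  · intro h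
    have := congrArg (coeff (Finsupp.single i 1)) h
    simp [coeff_C_mul, coeff_X, hij.symm, Finsupp.single_left_inj] at this
  · change aeval v f ≠ 0
    rwa [hfe]
  · change IsRelPrime (aeval v f) (aeval v g)
    rw [hfe]
    exact isRelPrime_of_mem_supported hst.symm hf (aeval_mem_supported hvs hg) hf0 hg0

/-- Relative to nonzero `f ∈ k[z,w]` and `g ∈ k[x,y]`, generic linear forms in `x, y` and in `z, w`
are regular modulo `⟨f, g⟩`. -/
theorem exists_regular_linear_forms [Infinite k] {f g : Rk k}
    (hf : f ∈ supported k ({2, 3} : Set (Fin 4))) (hg : g ∈ supported k ({0, 1} : Set (Fin 4)))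
    (hf0 : f ≠ 0) (hg0 : g ≠ 0) :
    ∃ a b : k, ∀ u, (X 0 - C a * X 1) * (X 2 - C b * X 3) * u ∈ Ideal.span {f, g} →
      u ∈ Ideal.span {f, g} := by
  obtain ⟨P, hP⟩ : ∃ P : Fin 4 → k, eval P (f * g * X 1 * X 3) ≠ 0 := by
    by_contra! h
    have h' : f * g * X 1 * X 3 = 0 := funext fun P => by rw [h, map_zero]
    simp [hf0, hg0, X_ne_zero] at h'
  simp only [map_mul, eval_X, ne_eq, mul_eq_zero, not_or] at hP
  obtain ⟨⟨⟨hPf, hPg⟩, hP1⟩, hP3⟩ := hP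
  have hst : Disjoint ({0, 1} : Set (Fin 4)) {2, 3} := by
    simp [Set.disjoint_left]
  refine ⟨P 0 / P 1, P 2 / P 3, fun u hu => ?_⟩
  rw [mul_assoc] at hu
  have h := mem_span_pair_of_X_sub_mul_mem hst (i := 0) (j := 1) (by decide) (by simp) (by simp)
    hf hg hf0 hPg hP1 _ hu
  rw [Ideal.span_pair_comm] at h ⊢
  exact mem_span_pair_of_X_sub_mul_mem hst.symm (i := 2) (j := 3) (by decide) (by simp) (by simp)
    hg hf hg0 hPf hP3 _ h

theorem NoCommonZeros.exists_pow_mem [IsAlgClosed k] {p0 p1 p2 : Rk k}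
    (h : NoCommonZeros p0 p1 p2) (a b : k) :
    ∃ n : ℕ, ((X 0 - C a * X 1) * (X 2 - C b * X 3)) ^ n ∈ Ideal.span {p0, p1, p2} := by
  suffices (X 0 - C a * X 1) * (X 2 - C b * X 3) ∈ (Ideal.span {p0, p1, p2}).radical from this
  rw [← vanishingIdeal_zeroLocus_eq_radical (K := k), mem_vanishingIdeal_iff]
  intro P hP
  have hz : ∀ p ∈ ({p0, p1, p2} : Set (Rk k)), eval P p = 0 := fun p hp => by
    simpa [coe_aeval_eq_eval] using hP p (Ideal.subset_span hp)
  simp only [Set.mem_insert_iff, Set.mem_singleton_iff, forall_eq_or_imp, forall_eq] at hz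
  have hPe : P = ![P 0, P 1, P 2, P 3] := by
    ext i
    fin_cases i <;> rfl
  by_cases h0 : (P 0, P 1) = (0, 0)
  · simp only [Prod.mk.injEq] at h0
    simp [h0]
  by_cases h2 : (P 2, P 3) = (0, 0)
  · simp only [Prod.mk.injEq] at h2
    simp [h2]
  have := h _ _ _ _ h0 h2
  rw [← hPe] at this
  simp [hz] at this

theorem RingTheory.Sequence.IsRegular.isRelPrime {R : Type*} [CommRing R] [IsDomain R] {p q : R}
    (h : IsRegular R [p, q]) : p ≠ 0 ∧ IsRelPrime p q := by
  have hw := h.toIsWeaklyRegular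
  rw [isWeaklyRegular_cons_iff, isWeaklyRegular_singleton_iff] at hw
  obtain ⟨hp, hq⟩ := hw
  have hp0 : p ≠ 0 := by
    rintro rfl
    exact one_ne_zero (hp (by simp : (0 : R) • (1 : R) = (0 : R) • 0))
  refine ⟨hp0, ?_⟩
  rintro d ⟨u, hu⟩ ⟨v, hv⟩
  have hmem := mem_of_isSMulRegular_quotient_of_smul_mem hq (x := u)
    (Submodule.mem_smul_pointwise_iff_exists _ _ _ |>.2
      ⟨v, Submodule.mem_top, by simp only [smul_eq_mul]; rw [hv, hu]; ring⟩)
  obtain ⟨c, -, hc⟩ := (Submodule.mem_smul_pointwise_iff_exists _ _ _).1 hmem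
  have hu0 : u ≠ 0 := by
    rintro rfl
    exact hp0 (by rw [hu, mul_zero])
  refine IsUnit.of_mul_eq_one c (mul_left_cancel₀ hu0 ?_)
  rw [smul_eq_mul] at hc
  linear_combination hc - c * hu

end Colon

section Generic

variable {k : Type*} [Field k]

/-- If `A z + B w` and `A' z + B' w` are coprime and nonzero, their `2 × 2` minor is nonzero. -/
theorem minor_ne_zero_of_isRelPrime {A B A' B' p q : Rk k}
    (hA : A ∈ supported k ({0, 1} : Set (Fin 4))) (hB : B ∈ supported k ({0, 1} : Set (Fin 4)))
    (hp : p = A * X 2 + B * X 3) (hq : q = A' * X 2 + B' * X 3) (hp0 : p ≠ 0)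
    (hpq : IsRelPrime p q) : A * B' - A' * B ≠ 0 := by
  intro h
  let φ : Rk k →ₐ[k] Rk k := aeval ![X 0, X 1, 0, 0]
  have hφ : ∀ f ∈ supported k ({0, 1} : Set (Fin 4)), φ f = f := fun f hf =>
    aeval_eq_self_of_mem_supported (fun i hi => by rcases hi with rfl | rfl <;> rfl) hf
  have hφp : φ p = 0 := by
    rw [hp]
    simp [φ]
  have eq_zero : ∀ f f' : Rk k, f ∈ supported k ({0, 1} : Set (Fin 4)) → q * f = p * f' →
      f = 0 := by
    intro f f' hf e
    obtain ⟨c, hc, -⟩ := hpq.exists_eq_mul_of_mul_eq_mul hp0 e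
    rw [← hφ f hf, hc, map_mul, hφp, zero_mul]
  refine hp0 ?_
  rw [hp, eq_zero A A' hA (by linear_combination A * hq - A' * hp + X 3 * h),
    eq_zero B B' hB (by linear_combination B * hq - B' * hp - X 2 * h), zero_mul, zero_mul,
    add_zero]

theorem quadForm_mul_add (u v : Fin 3 → k) : quadForm u * X 2 + quadForm v * X 3 =
    (C (u 0) * X 2 + C (v 0) * X 3) * X 0 ^ 2 + (C (u 1) * X 2 + C (v 1) * X 3) * (X 0 * X 1) +
      (C (u 2) * X 2 + C (v 2) * X 3) * X 1 ^ 2 := by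
  simp only [quadForm]
  ring

/-- In the generic case the determinant of the coefficients of `x², xy, y²` is nonzero. -/
theorem BidegGeneric.coeff_det_ne_zero [IsAlgClosed k] {p0 p1 p2 : Rk k}
    (h0 : Bihom p0 2 1) (h1 : Bihom p1 2 1) (h2 : Bihom p2 2 1)
    (hncz : NoCommonZeros p0 p1 p2) (hgen : BidegGeneric p0 p1 p2)
    {C0 D0 E0 C1 D1 E1 C2 D2 E2 : Rk k}
    (hC0 : Bihom C0 0 1) (hD0 : Bihom D0 0 1) (hE0 : Bihom E0 0 1)
    (hC1 : Bihom C1 0 1) (hD1 : Bihom D1 0 1) (hE1 : Bihom E1 0 1)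
    (hC2 : Bihom C2 0 1) (hD2 : Bihom D2 0 1) (hE2 : Bihom E2 0 1)
    (hp0 : p0 = C0 * X 0 ^ 2 + D0 * (X 0 * X 1) + E0 * X 1 ^ 2)
    (hp1 : p1 = C1 * X 0 ^ 2 + D1 * (X 0 * X 1) + E1 * X 1 ^ 2)
    (hp2 : p2 = C2 * X 0 ^ 2 + D2 * (X 0 * X 1) + E2 * X 1 ^ 2) :
    C0 * (D1 * E2 - D2 * E1) - D0 * (C1 * E2 - C2 * E1) + E0 * (C1 * D2 - C2 * D1) ≠ 0 := by
  obtain ⟨c0, c0', rfl⟩ := hC0.exists_linear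
  obtain ⟨d0, d0', rfl⟩ := hD0.exists_linear
  obtain ⟨e0, e0', rfl⟩ := hE0.exists_linear
  obtain ⟨c1, c1', rfl⟩ := hC1.exists_linear
  obtain ⟨d1, d1', rfl⟩ := hD1.exists_linear
  obtain ⟨e1, e1', rfl⟩ := hE1.exists_linear
  obtain ⟨c2, c2', rfl⟩ := hC2.exists_linear
  obtain ⟨d2, d2', rfl⟩ := hD2.exists_linear
  obtain ⟨e2, e2', rfl⟩ := hE2.exists_linear
  obtain ⟨c, hc⟩ := hgen.exists_det_ne_zero
    (M := !![c0, d0, e0; c1, d1, e1; c2, d2, e2])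
    (N := !![c0', d0', e0'; c1', d1', e1'; c2', d2', e2'])
    (hp0.trans (quadForm_mul_add ![c0, d0, e0] ![c0', d0', e0']).symm)
    (hp1.trans (quadForm_mul_add ![c1, d1, e1] ![c1', d1', e1']).symm)
    (hp2.trans (quadForm_mul_add ![c2, d2, e2] ![c2', d2', e2']).symm) h0 h1 h2 hncz
  refine fun h => hc ?_
  have hev := congrArg (eval ![0, 0, c, 1]) h
  simp at hev
  simp [Matrix.det_fin_three]
  linear_combination hev

/-- The ideal quotient `(⟨p0, p1⟩ : p2)` multiplies `x², xy, y²` times `z` or `w` into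
`⟨p0, p1⟩`, provided the coefficient determinant and the minor `g` are coprime. -/
theorem mem_span_pair_of_mul_mem_of_isRelPrime {R : Type*} [CommRing R] [IsDomain R]
    [DecompositionMonoid R] {x y z w p0 p1 p2 C0 D0 E0 C1 D1 E1 C2 D2 E2 A0 B0 A1 B1 t f : R}
    (hp0 : p0 ≠ 0) (hpq : IsRelPrime p0 p1)
    (hpC0 : p0 = C0 * x ^ 2 + D0 * (x * y) + E0 * y ^ 2)
    (hpC1 : p1 = C1 * x ^ 2 + D1 * (x * y) + E1 * y ^ 2)
    (hpC2 : p2 = C2 * x ^ 2 + D2 * (x * y) + E2 * y ^ 2)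
    (hpA0 : p0 = A0 * z + B0 * w) (hpA1 : p1 = A1 * z + B1 * w)
    (hd : C0 * (D1 * E2 - D2 * E1) - D0 * (C1 * E2 - C2 * E1) + E0 * (C1 * D2 - C2 * D1) ≠ 0)
    (hdg : IsRelPrime
      (C0 * (D1 * E2 - D2 * E1) - D0 * (C1 * E2 - C2 * E1) + E0 * (C1 * D2 - C2 * D1))
      (A0 * B1 - A1 * B0))
    (ht : t ∈ Ideal.span {p0, p1, p2})
    (htr : ∀ u, t * u ∈ Ideal.span
      {C0 * (D1 * E2 - D2 * E1) - D0 * (C1 * E2 - C2 * E1) + E0 * (C1 * D2 - C2 * D1),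
        A0 * B1 - A1 * B0} → u ∈ Ideal.span
      {C0 * (D1 * E2 - D2 * E1) - D0 * (C1 * E2 - C2 * E1) + E0 * (C1 * D2 - C2 * D1),
        A0 * B1 - A1 * B0})
    (hf : f * p2 ∈ Ideal.span {p0, p1}) {q l : R} (hq : q ∈ ({x ^ 2, x * y, y ^ 2} : Set R))
    (hl : l ∈ ({z, w} : Set R)) : q * l * f ∈ Ideal.span {p0, p1} := by
  have hm0 : p0 ∈ Ideal.span {p0, p1} := Ideal.mem_span_pair.2 ⟨1, 0, by ring⟩
  have hm1 : p1 ∈ Ideal.span {p0, p1} := Ideal.mem_span_pair.2 ⟨0, 1, by ring⟩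
  have comb : ∀ a b c : R, (a * p0 + b * p1 + c * p2) * f ∈ Ideal.span {p0, p1} := by
    intro a b c
    have := add_mem (add_mem (Ideal.mul_mem_left _ (a * f) hm0) (Ideal.mul_mem_left _ (b * f) hm1))
      (Ideal.mul_mem_left _ c hf)
    convert this using 1
    ring
  refine mem_span_pair_of_three_mul_mem hp0 hpq hd hdg htr ?_ ?_ ?_
  · rcases hq with rfl | rfl | rfl
    · convert Ideal.mul_mem_left _ l
        (comb (D1 * E2 - D2 * E1) (-(D0 * E2 - D2 * E0)) (D0 * E1 - D1 * E0)) using 1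
      rw [hpC0, hpC1, hpC2]
      ring
    · convert Ideal.mul_mem_left _ l
        (comb (-(C1 * E2 - C2 * E1)) (C0 * E2 - C2 * E0) (-(C0 * E1 - C1 * E0))) using 1
      rw [hpC0, hpC1, hpC2]
      ring
    · convert Ideal.mul_mem_left _ l
        (comb (C1 * D2 - C2 * D1) (-(C0 * D2 - C2 * D0)) (C0 * D1 - C1 * D0)) using 1
      rw [hpC0, hpC1, hpC2]
      ring
  · rcases hl with rfl | rfl
    · exact Ideal.mem_span_pair.2 ⟨B1 * q * f, -(B0 * q * f), by rw [hpA0, hpA1]; ring⟩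
    · exact Ideal.mem_span_pair.2 ⟨-(A1 * q * f), A0 * q * f, by rw [hpA0, hpA1]; ring⟩
  · obtain ⟨a, h⟩ := (Ideal.mem_span_insert' _ _ _).1 ht
    obtain ⟨b, c, h⟩ := Ideal.mem_span_pair.1 h
    convert Ideal.mul_mem_left _ (q * l) (comb (-a) b c) using 1
    linear_combination -(q * l * f) * h

/-- The generators `k1, k2, g` multiply `p2` into `⟨p0, p1⟩`. -/
theorem span_le_colon_span_singleton {R : Type*} [CommRing R]
    {x y z w C0 D0 E0 C1 D1 E1 C2 D2 E2 A0 B0 A1 B1 A2 B2 p0 p1 p2 : R}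
    (hpC0 : p0 = C0 * x ^ 2 + D0 * (x * y) + E0 * y ^ 2)
    (hpC1 : p1 = C1 * x ^ 2 + D1 * (x * y) + E1 * y ^ 2)
    (hpC2 : p2 = C2 * x ^ 2 + D2 * (x * y) + E2 * y ^ 2)
    (hpA0 : p0 = A0 * z + B0 * w) (hpA1 : p1 = A1 * z + B1 * w) (hpA2 : p2 = A2 * z + B2 * w) :
    Ideal.span {p0, p1, (C0 * x + D0 * y) * E1 - (C1 * x + D1 * y) * E0,
      C0 * (D1 * x + E1 * y) - C1 * (D0 * x + E0 * y), A0 * B1 - A1 * B0} ≤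
    Submodule.colon (Ideal.span {p0, p1}) (Ideal.span {p2} : Set R) := by
  rw [Ideal.span_le]
  intro f hf
  refine Submodule.mem_colon_span_singleton.2 (Ideal.mem_span_pair.2 ?_)
  rcases hf with rfl | rfl | rfl | rfl | rfl
  · exact ⟨p2, 0, by simp only [smul_eq_mul]; ring⟩
  · exact ⟨0, p2, by simp only [smul_eq_mul]; ring⟩
  · refine ⟨(C2 * x + D2 * y) * E1 - E2 * (C1 * x + D1 * y),
      E2 * (C0 * x + D0 * y) - (C2 * x + D2 * y) * E0, ?_⟩
    rw [hpC0, hpC1, hpC2, smul_eq_mul]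
    ring
  · refine ⟨C2 * (D1 * x + E1 * y) - C1 * (D2 * x + E2 * y),
      C0 * (D2 * x + E2 * y) - C2 * (D0 * x + E0 * y), ?_⟩
    rw [hpC0, hpC1, hpC2, smul_eq_mul]
    ring
  · refine ⟨A2 * B1 - A1 * B2, A0 * B2 - A2 * B0, ?_⟩
    rw [hpA0, hpA1, hpA2, smul_eq_mul]
    ring

end Generic

/-- In the generic case, with `p0, p1` a regular sequence, the ideal
quotient `(⟨p0, p1⟩ : p2)` equals `⟨p0, p1, k1, k2, g⟩`, where `k1, k2, g` are the explicit
polynomials built from the two decompositions of `p0, p1`. -/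
theorem statement16 {k : Type*} [Field k] [IsAlgClosed k] (p0 p1 p2 : Rk k)
    (h0 : Bihom p0 2 1) (h1 : Bihom p1 2 1) (h2 : Bihom p2 2 1)
    (hncz : NoCommonZeros p0 p1 p2) (hgen : BidegGeneric p0 p1 p2)
    (hreg : RingTheory.Sequence.IsRegular (Rk k) [p0, p1])
    (C0 D0 E0 C1 D1 E1 : Rk k)
    (hC0 : Bihom C0 0 1) (hD0 : Bihom D0 0 1) (hE0 : Bihom E0 0 1)
    (hC1 : Bihom C1 0 1) (hD1 : Bihom D1 0 1) (hE1 : Bihom E1 0 1)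
    (hpC0 : p0 = C0 * X 0 ^ 2 + D0 * (X 0 * X 1) + E0 * X 1 ^ 2)
    (hpC1 : p1 = C1 * X 0 ^ 2 + D1 * (X 0 * X 1) + E1 * X 1 ^ 2)
    (A0 B0 A1 B1 : Rk k)
    (hA0 : Bihom A0 2 0) (hB0 : Bihom B0 2 0) (hA1 : Bihom A1 2 0) (hB1 : Bihom B1 2 0)
    (hpA0 : p0 = A0 * X 2 + B0 * X 3)
    (hpA1 : p1 = A1 * X 2 + B1 * X 3) :
    Submodule.colon (Ideal.span ({p0, p1} : Set (Rk k)))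
        (Ideal.span ({p2} : Set (Rk k)))
      = Ideal.span ({p0, p1,
          (C0 * X 0 + D0 * X 1) * E1 - (C1 * X 0 + D1 * X 1) * E0,
          C0 * (D1 * X 0 + E1 * X 1) - C1 * (D0 * X 0 + E0 * X 1),
          A0 * B1 - A1 * B0} : Set (Rk k)) := by
  obtain ⟨hp0, hpq⟩ := hreg.isRelPrime
  obtain ⟨u, v, hpA2⟩ := h2.exists_quadForm
  have hpC2 := hpA2.trans (quadForm_mul_add u v)
  have linear : ∀ a b : k, Bihom (C a * X 2 + C b * X 3 : Rk k) 0 1 := fun a b => by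
    have hX : ∀ (a : k) (i : Fin 4), bidegWt i = (0, 1) → Bihom (C a * X i) 0 1 := fun a i hi => by
      have := (isWeightedHomogeneous_C bidegWt a).mul (isWeightedHomogeneous_X k bidegWt i)
      rwa [hi, zero_add] at this
    exact (hX a 2 rfl).add (hX b 3 rfl)
  have hd := hgen.coeff_det_ne_zero h0 h1 h2 hncz hC0 hD0 hE0 hC1 hD1 hE1 (linear _ _)
    (linear _ _) (linear _ _) hpC0 hpC1 hpC2
  have hg := minor_ne_zero_of_isRelPrime hA0.mem_supported_of_right_eq_zero
    hB0.mem_supported_of_right_eq_zero hpA0 hpA1 hp0 hpq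
  have hgs : A0 * B1 - A1 * B0 ∈ supported k ({0, 1} : Set (Fin 4)) :=
    sub_mem (mul_mem hA0.mem_supported_of_right_eq_zero hB1.mem_supported_of_right_eq_zero)
      (mul_mem hA1.mem_supported_of_right_eq_zero hB0.mem_supported_of_right_eq_zero)
  set C2 : Rk k := C (u 0) * X 2 + C (v 0) * X 3
  set D2 : Rk k := C (u 1) * X 2 + C (v 1) * X 3
  set E2 : Rk k := C (u 2) * X 2 + C (v 2) * X 3
  have hds : C0 * (D1 * E2 - D2 * E1) - D0 * (C1 * E2 - C2 * E1) + E0 * (C1 * D2 - C2 * D1) ∈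
      supported k ({2, 3} : Set (Fin 4)) := by
    have hC2 : C2 ∈ supported k ({2, 3} : Set (Fin 4)) :=
      (linear _ _).mem_supported_of_left_eq_zero
    have hD2 : D2 ∈ supported k ({2, 3} : Set (Fin 4)) :=
      (linear _ _).mem_supported_of_left_eq_zero
    have hE2 : E2 ∈ supported k ({2, 3} : Set (Fin 4)) :=
      (linear _ _).mem_supported_of_left_eq_zero
    replace hC0 := hC0.mem_supported_of_left_eq_zero
    replace hD0 := hD0.mem_supported_of_left_eq_zero
    replace hE0 := hE0.mem_supported_of_left_eq_zero
    replace hC1 := hC1.mem_supported_of_left_eq_zero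
    replace hD1 := hD1.mem_supported_of_left_eq_zero
    replace hE1 := hE1.mem_supported_of_left_eq_zero
    exact add_mem (sub_mem (mul_mem hC0 (sub_mem (mul_mem hD1 hE2) (mul_mem hD2 hE1)))
      (mul_mem hD0 (sub_mem (mul_mem hC1 hE2) (mul_mem hC2 hE1))))
      (mul_mem hE0 (sub_mem (mul_mem hC1 hD2) (mul_mem hC2 hD1)))
  have hst : Disjoint ({2, 3} : Set (Fin 4)) {0, 1} := by
    simp [Set.disjoint_left]
  have hdg := isRelPrime_of_mem_supported hst hds hgs hd hg
  obtain ⟨a, b, hab⟩ := exists_regular_linear_forms hds hgs hd hg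
  obtain ⟨n, hn⟩ := hncz.exists_pow_mem a b
  refine le_antisymm (fun f hf => ?_)
    (span_le_colon_span_singleton hpC0 hpC1 hpC2 hpA0 hpA1 hpA2)
  have hf' : f * p2 ∈ Ideal.span {p0, p1} := Submodule.mem_colon_span_singleton.1 hf
  have hpow : ∀ (m : ℕ) (t : Rk k), ((X 0 - C a * X 1) * (X 2 - C b * X 3)) ^ m * t ∈ Ideal.span
      {C0 * (D1 * E2 - D2 * E1) - D0 * (C1 * E2 - C2 * E1) + E0 * (C1 * D2 - C2 * D1),
        A0 * B1 - A1 * B0} → t ∈ Ideal.span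
      {C0 * (D1 * E2 - D2 * E1) - D0 * (C1 * E2 - C2 * E1) + E0 * (C1 * D2 - C2 * D1),
        A0 * B1 - A1 * B0} := by
    intro m
    induction m with
    | zero => simp
    | succ m ih =>
      intro t ht
      rw [pow_succ, mul_assoc] at ht
      exact hab _ (ih _ ht)
  have key : ∀ q ∈ ({X 0 ^ 2, X 0 * X 1, X 1 ^ 2} : Set (Rk k)),
      ∀ l ∈ ({X 2, X 3} : Set (Rk k)), q * l * f ∈ Ideal.span {p0, p1} := fun q hq l hl =>
    mem_span_pair_of_mul_mem_of_isRelPrime hp0 hpq hpC0 hpC1 hpC2 hpA0 hpA1 hd hdg hn (hpow n)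
      hf' hq hl
  have hX : ∀ i j : Fin 4, i ≠ j → IsRelPrime (X i : Rk k) (X j) := fun i j hij =>
    isRelPrime_of_mem_supported (Set.disjoint_singleton.2 hij) (X_mem_supported.2 rfl)
      (X_mem_supported.2 rfl) (X_ne_zero i) (X_ne_zero j)
  refine mem_span_of_mul_mem (X_ne_zero 0) (X_ne_zero 2) (hX 0 1 (by decide)) (hX 2 3 (by decide))
    hp0 hpq hpC0 hpC1 hpA0 hpA1
    (aeval ![X 0, X 1, 0, 0] : Rk k →ₐ[k] Rk k).toRingHom (by simp) (by simp) (by simp) (by simp)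
    (fun p => sub_aeval_mem (fun i => ?_) p)
    (key _ (by simp) _ (by simp)) (key _ (by simp) _ (by simp)) (key _ (by simp) _ (by simp))
    (key _ (by simp) _ (by simp)) (key _ (by simp) _ (by simp)) (key _ (by simp) _ (by simp))
  fin_cases i
  · simp
  · simp
  · simpa using Ideal.subset_span (by simp : (X 2 : Rk k) ∈ _)
  · simpa using Ideal.subset_span (by simp : (X 3 : Rk k) ∈ _)
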